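/- arXiv:2403.01216 — 3 statements merged into one kernel-verified Lean document; each statement's English description precedes it below -/
import Mathlib

section
/- Split conformal prediction coverage guarantee (Theorem 2.1): Let n ≥ 1, let α ∈ (0,1) satisfy ⌈(n+1)(1−α)⌉ ≤ n, and set k = ⌈(n+1)(1−α)⌉. Let μ be a Borel probability measure on ℝ and equip the space of tuples s : Fin (n+1) → ℝ with the product measure μ^{⊗(n+1)} (i.e., the nonconformity scores S₁,…,Sₙ of the calibration set and the test score S_{n+1} are i.i.d. with law μ). Define q̂(s) to be the k-th smallest value among s(1),…,s(n). Then μ^{⊗(n+1)} { s : s(n+1) ≤ q̂(s) } ≥ 1 − α. -/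
open MeasureTheory

/-- The `k`-th smallest value (1-indexed) of a finite tuple in a linear order:
the value in position `k` after sorting the tuple in nondecreasing order. -/
noncomputable def kthSmallest {m : ℕ} {α : Type*} [LinearOrder α]
    (s : Fin m → α) (k : ℕ) (h : k - 1 < m) : α :=
  s (Tuple.sort s ⟨k - 1, h⟩)

/-- The number of coordinates of `s` lying strictly below the coordinate `s j`. -/
noncomputable def strictRank {m : ℕ} (s : Fin m → ℝ) (j : Fin m) : ℕ :=
  ∑ i, if s i < s j then 1 else 0

theorem strictRank_eq_card {m : ℕ} (s : Fin m → ℝ) (j : Fin m) :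
    strictRank s j = (Finset.univ.filter fun i => s i < s j).card := by
  simp [strictRank]

theorem measurable_strictRank {m : ℕ} (j : Fin m) :
    Measurable fun s : Fin m → ℝ => strictRank s j := by
  unfold strictRank
  refine Finset.measurable_sum _ fun i _ => Measurable.ite ?_ measurable_const measurable_const
  exact measurableSet_lt (measurable_pi_apply i) (measurable_pi_apply j)

theorem strictRank_comp_perm {m : ℕ} (s : Fin m → ℝ) (e : Equiv.Perm (Fin m)) (j : Fin m) :
    strictRank (s ∘ e) j = strictRank s (e j) :=
  Equiv.sum_comp e fun i => if s i < s (e j) then 1 else 0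

theorem strictRank_sort_le {m : ℕ} (s : Fin m → ℝ) (a : Fin m) :
    strictRank s (Tuple.sort s a) ≤ a := by
  rw [← strictRank_comp_perm, strictRank_eq_card, ← Fin.card_Iio]
  refine Finset.card_le_card fun i hi => ?_
  rw [Finset.mem_filter] at hi
  exact Finset.mem_Iio.2 ((Tuple.monotone_sort s).reflect_lt hi.2)

theorem le_card_strictRank_lt {m k : ℕ} (hk : k ≤ m) (s : Fin m → ℝ) :
    k ≤ (Finset.univ.filter fun j => strictRank s j < k).card := by
  have h : (Finset.univ.image fun a : Fin k => Tuple.sort s (Fin.castLE hk a)) ⊆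
      Finset.univ.filter fun j => strictRank s j < k := by
    intro j hj
    obtain ⟨a, -, rfl⟩ := Finset.mem_image.1 hj
    exact Finset.mem_filter.2
      ⟨Finset.mem_univ _, (strictRank_sort_le s (Fin.castLE hk a)).trans_lt a.2⟩
  refine le_trans (le_of_eq ?_) (Finset.card_le_card h)
  have hinj : Function.Injective fun a : Fin k => Tuple.sort s (Fin.castLE hk a) :=
    (Tuple.sort s).injective.comp (Fin.castLE_injective hk)
  rw [Finset.card_image_of_injective _ hinj, Finset.card_univ, Fintype.card_fin]

theorem le_kthSmallest_of_strictRank_lt {n k : ℕ} (s : Fin (n + 1) → ℝ) (h : k - 1 < n)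
    (hs : strictRank s (Fin.last n) < k) :
    s (Fin.last n) ≤ kthSmallest (fun i : Fin n => s i.castSucc) k h := by
  by_contra! hlt
  have hkn : k ≤ n := by omega
  let t : Fin n → ℝ := fun i => s i.castSucc
  have hsub : (Finset.univ.image fun a : Fin k => (Tuple.sort t (Fin.castLE hkn a)).castSucc) ⊆
      Finset.univ.filter fun i => s i < s (Fin.last n) := by
    intro j hj
    obtain ⟨a, -, rfl⟩ := Finset.mem_image.1 hj
    refine Finset.mem_filter.2 ⟨Finset.mem_univ _, lt_of_le_of_lt ?_ hlt⟩
    have ha : Fin.castLE hkn a ≤ ⟨k - 1, h⟩ := Nat.le_sub_one_of_lt a.2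
    exact Tuple.monotone_sort t ha
  have hcard := Finset.card_le_card hsub
  have hinj : Function.Injective fun a : Fin k => (Tuple.sort t (Fin.castLE hkn a)).castSucc :=
    (Fin.castSucc_injective n).comp
      ((Tuple.sort t).injective.comp (Fin.castLE_injective hkn))
  rw [Finset.card_image_of_injective _ hinj, Finset.card_univ, Fintype.card_fin,
    ← strictRank_eq_card] at hcard
  omega

theorem measurePreserving_comp_perm {ι X : Type*} [Fintype ι] [MeasurableSpace X]
    (μ : Measure X) [SigmaFinite μ] (e : Equiv.Perm ι) :
    MeasurePreserving (fun s : ι → X => s ∘ e) (Measure.pi fun _ => μ) (Measure.pi fun _ => μ) := by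
  convert measurePreserving_piCongrLeft (fun _ : ι => μ) e.symm using 1
  ext s i
  simpa [MeasurableEquiv.coe_piCongrLeft] using
    (Equiv.piCongrLeft_apply_apply (fun _ : ι => X) e.symm s (e i)).symm

theorem measure_strictRank_lt_eq {m : ℕ} (μ : Measure ℝ) [SigmaFinite μ] (k : ℕ) (i j : Fin m) :
    Measure.pi (fun _ : Fin m => μ) {s | strictRank s i < k} =
      Measure.pi (fun _ : Fin m => μ) {s | strictRank s j < k} := by
  have hmeas : MeasurableSet {s : Fin m → ℝ | strictRank s i < k} :=
    measurable_strictRank i measurableSet_Iio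
  rw [← (measurePreserving_comp_perm μ (Equiv.swap i j)).measure_preimage hmeas.nullMeasurableSet]
  simp only [Set.preimage, Set.mem_ofPred_eq, strictRank_comp_perm, Equiv.swap_apply_left]

theorem le_mul_measure_strictRank_lt {m k : ℕ} (hk : k ≤ m) (μ : Measure ℝ)
    [IsProbabilityMeasure μ] (j : Fin m) :
    (k : ENNReal) ≤ m * Measure.pi (fun _ : Fin m => μ) {s | strictRank s j < k} := by
  have hmeas (i : Fin m) : MeasurableSet {s : Fin m → ℝ | strictRank s i < k} :=
    measurable_strictRank i measurableSet_Iio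
  calc (k : ENNReal)
      = ∫⁻ _, (k : ENNReal) ∂(Measure.pi fun _ : Fin m => μ) := by simp
    _ ≤ ∫⁻ s, ∑ i, {s : Fin m → ℝ | strictRank s i < k}.indicator 1 s
          ∂(Measure.pi fun _ : Fin m => μ) := by
        refine lintegral_mono fun s => ?_
        simpa [Set.indicator_apply] using le_card_strictRank_lt hk s
    _ = ∑ i, Measure.pi (fun _ : Fin m => μ) {s | strictRank s i < k} := by
        rw [lintegral_finsetSum _ fun i _ => measurable_one.indicator (hmeas i)]
        exact Finset.sum_congr rfl fun i _ => lintegral_indicator_one (hmeas i)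
    _ = m * Measure.pi (fun _ : Fin m => μ) {s | strictRank s j < k} := by
        rw [Finset.sum_congr rfl fun i _ => measure_strictRank_lt_eq μ k i j]
        simp

/-- Split conformal prediction coverage guarantee: if the `n` calibration scores and the
test score are i.i.d. with law `μ`, and `q̂` is the `⌈(n+1)(1-α)⌉`-th smallest calibration
score, then the probability that the test score is at most `q̂` is at least `1 - α`. -/
theorem split_conformal_coverage
    (n : ℕ) (hn : 1 ≤ n) (α : ℝ) (hα : α ∈ Set.Ioo (0 : ℝ) 1)
    (k : ℕ) (hk : k = ⌈((n : ℝ) + 1) * (1 - α)⌉₊) (hkn : k ≤ n)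
    (μ : Measure ℝ) [IsProbabilityMeasure μ] :
    ENNReal.ofReal (1 - α) ≤
      Measure.pi (fun _ : Fin (n + 1) => μ)
        { s : Fin (n + 1) → ℝ |
          s (Fin.last n) ≤
            kthSmallest (fun i : Fin n => s i.castSucc) k (by omega) } := by
  refine le_trans ?_ (measure_mono fun s hs => le_kthSmallest_of_strictRank_lt s (by omega) hs)
  have hbound := le_mul_measure_strictRank_lt (hkn.trans n.le_succ) μ (Fin.last n)
  have hceil : ((n : ℝ) + 1) * (1 - α) ≤ k := hk ▸ Nat.le_ceil _
  have hle : ((n + 1 : ℕ) : ENNReal) * ENNReal.ofReal (1 - α) ≤ k := by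
    rw [← ENNReal.ofReal_natCast (n + 1), ← ENNReal.ofReal_natCast k,
      ← ENNReal.ofReal_mul (Nat.cast_nonneg _)]
    exact ENNReal.ofReal_le_ofReal (by exact_mod_cast hceil)
  exact (ENNReal.mul_le_mul_iff_right (by simp) (ENNReal.natCast_ne_top _)).1 (hle.trans hbound)
end

section
/- Exact count of covered indices for distinct scores: Let n ≥ 1, let a : Fin (n+1) → ℝ be injective (pairwise distinct scores), and let k satisfy 1 ≤ k ≤ n. For each index i, let q_i denote the k-th smallest value among the n values { a(j) : j ≠ i }. Then the cardinality of { i : a(i) ≤ q_i } equals exactly k. -/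
/-- A value is at most the `k`-th smallest entry iff fewer than `k` entries lie strictly below it. -/
theorem le_kthSmallest_iff {m : ℕ} {α : Type*} [LinearOrder α] (s : Fin m → α) (k : ℕ)
    (hk : 1 ≤ k) (h : k - 1 < m) (x : α) :
    x ≤ kthSmallest s k h ↔ (Finset.univ.filter fun j => s j < x).card < k := by
  have hmono : Monotone (s ∘ Tuple.sort s) := Tuple.monotone_sort s
  have hcard : (Finset.univ.filter fun j => s j < x).card =
      (Finset.univ.filter fun p => s (Tuple.sort s p) < x).card :=
    (Finset.card_equiv (Tuple.sort s) (by simp)).symm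
  rw [hcard]
  constructor
  · intro hx
    have hsub : (Finset.univ.filter fun p => s (Tuple.sort s p) < x) ⊆
        Finset.Iio (⟨k - 1, h⟩ : Fin m) := by
      intro p hp
      rw [Finset.mem_filter] at hp
      rw [Finset.mem_Iio]
      by_contra! hle
      exact absurd (hx.trans (hmono hle)) (not_le.mpr hp.2)
    have := Finset.card_le_card hsub
    rw [Fin.card_Iio] at this
    simp only at this
    omega
  · contrapose!
    intro hx
    have hsub : Finset.Iic (⟨k - 1, h⟩ : Fin m) ⊆
        Finset.univ.filter fun p => s (Tuple.sort s p) < x := by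
      intro p hp
      rw [Finset.mem_Iic] at hp
      exact Finset.mem_filter.mpr ⟨Finset.mem_univ _, (hmono hp).trans_lt hx⟩
    have := Finset.card_le_card hsub
    rw [Fin.card_Iic] at this
    simp only at this
    omega

/-- Removing the `i`-th entry does not change the number of entries strictly below it. -/
theorem card_filter_succAbove_lt {n : ℕ} {α : Type*} [LinearOrder α] (a : Fin (n + 1) → α)
    (i : Fin (n + 1)) :
    (Finset.univ.filter fun j : Fin n => a (i.succAbove j) < a i).card =
      (Finset.univ.filter fun j => a j < a i).card := by
  simp only [Finset.card_filter]
  rw [Fin.sum_univ_succAbove _ i]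
  simp

/-- For an injective tuple, exactly `p` entries lie strictly below the entry in sorted
position `p` (0-indexed). -/
theorem card_filter_lt_sort {m : ℕ} {α : Type*} [LinearOrder α] (a : Fin m → α)
    (ha : Function.Injective a) (p : Fin m) :
    (Finset.univ.filter fun j => a j < a (Tuple.sort a p)).card = p := by
  have hmono : StrictMono (a ∘ Tuple.sort a) :=
    (Tuple.monotone_sort a).strictMono_of_injective (ha.comp (Tuple.sort a).injective)
  rw [← Fin.card_Iio p]
  refine (Finset.card_equiv (Tuple.sort a) fun q => ?_).symm
  simpa using (hmono.lt_iff_lt (a := q) (b := p)).symm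

/-- Exact count of covered indices for distinct scores: for pairwise distinct scores
`a : Fin (n+1) → ℝ` and `1 ≤ k ≤ n`, letting `q_i` be the `k`-th smallest of the scores
other than `a i`, exactly `k` indices `i` satisfy `a i ≤ q_i`. -/
theorem covered_count_eq
    (n : ℕ) (hn : 1 ≤ n) (a : Fin (n + 1) → ℝ) (ha : Function.Injective a)
    (k : ℕ) (hk1 : 1 ≤ k) (hkn : k ≤ n) :
    (Finset.univ.filter fun i : Fin (n + 1) =>
        a i ≤ kthSmallest (fun j : Fin n => a (i.succAbove j)) k (by omega)).card = k := by
  simp only [le_kthSmallest_iff _ k hk1, card_filter_succAbove_lt]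
  have hcard : (Finset.univ.filter fun p : Fin (n + 1) => (p : ℕ) < k).card = k := by
    rw [Fin.card_filter_val_lt]
    omega
  conv_rhs => rw [← hcard]
  refine (Finset.card_equiv (Tuple.sort a) fun p => ?_).symm
  simp [card_filter_lt_sort a ha]
end

section
/- Count lower bound for covered indices with possible ties: Let n ≥ 1, let a : Fin (n+1) → ℝ be any tuple of reals (ties allowed), and let k satisfy 1 ≤ k ≤ n. For each index i, let q_i denote the k-th smallest value among the n values { a(j) : j ≠ i }. Then the cardinality of { i : a(i) ≤ q_i } is at least k. -/
/-- If the `k`-th smallest value lies strictly below `x`, then so do at least `k` entries. -/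
theorem le_card_lt_of_kthSmallest_lt {m : ℕ} {α : Type*} [LinearOrder α]
    {s : Fin m → α} {k : ℕ} {h : k - 1 < m} {x : α} (hx : kthSmallest s k h < x) :
    k ≤ (Finset.univ.filter fun j => s j < x).card := by
  have hsub : (Finset.Iic (⟨k - 1, h⟩ : Fin m)).map (Tuple.sort s).toEmbedding ⊆
      Finset.univ.filter fun j => s j < x := by
    intro j hj
    obtain ⟨r, hr, rfl⟩ := Finset.mem_map.1 hj
    exact Finset.mem_filter.2 ⟨Finset.mem_univ _,
      (Tuple.monotone_sort s (Finset.mem_Iic.1 hr)).trans_lt hx⟩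
  have hcard := Finset.card_le_card hsub
  rw [Finset.card_map, Fin.card_Iic] at hcard
  dsimp only at hcard
  omega

/-- At most `p` entries lie strictly below the entry in (0-indexed) sorted position `p`. -/
theorem card_lt_sort_le {m : ℕ} {α : Type*} [LinearOrder α] (s : Fin m → α) (p : Fin m) :
    (Finset.univ.filter fun j => s j < s (Tuple.sort s p)).card ≤ p := by
  have hsub : (Finset.univ.filter fun j => s j < s (Tuple.sort s p)) ⊆
      (Finset.Iio p).map (Tuple.sort s).toEmbedding := by
    intro j hj
    obtain ⟨r, rfl⟩ := (Tuple.sort s).surjective j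
    exact Finset.mem_map_of_mem _ (Finset.mem_Iio.2
      ((Tuple.monotone_sort s).reflect_lt (Finset.mem_filter.1 hj).2))
  simpa using Finset.card_le_card hsub

/-- Precomposing a predicate with an injection does not increase the number of solutions. -/
theorem card_filter_comp_le {ι κ : Type*} [Fintype ι] [Fintype κ] {f : ι → κ}
    (hf : Function.Injective f) (P : κ → Prop) [DecidablePred P] :
    (Finset.univ.filter fun j => P (f j)).card ≤ (Finset.univ.filter P).card :=
  Finset.card_le_card_of_injOn f (fun j hj => by simpa using hj) hf.injOn

/-- Count lower bound for covered indices with possible ties: for any scores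
`a : Fin (n+1) → ℝ` and `1 ≤ k ≤ n`, letting `q_i` be the `k`-th smallest of the scores
other than `a i`, at least `k` indices `i` satisfy `a i ≤ q_i`. -/
theorem covered_count_ge
    (n : ℕ) (hn : 1 ≤ n) (a : Fin (n + 1) → ℝ)
    (k : ℕ) (hk1 : 1 ≤ k) (hkn : k ≤ n) :
    k ≤ (Finset.univ.filter fun i : Fin (n + 1) =>
        a i ≤ kthSmallest (fun j : Fin n => a (i.succAbove j)) k (by omega)).card := by
  have hinj : Function.Injective
      fun p : Fin k => Tuple.sort a (Fin.castLE (hkn.trans n.le_succ) p) :=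
    (Tuple.sort a).injective.comp (Fin.castLE_injective _)
  calc k = (Finset.univ.map ⟨_, hinj⟩).card := by simp
    _ ≤ _ := Finset.card_le_card ?_
  intro i hi
  obtain ⟨p, -, rfl⟩ := Finset.mem_map.1 hi
  refine Finset.mem_filter.2 ⟨Finset.mem_univ _, le_of_not_gt fun hlt => ?_⟩
  have hlow := le_card_lt_of_kthSmallest_lt hlt
  have hhigh := card_lt_sort_le a (Fin.castLE (hkn.trans n.le_succ) p)
  exact absurd (hlow.trans ((card_filter_comp_le Fin.succAbove_right_injective (a · < _)).trans hhigh))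
    (not_le.2 p.isLt)
end
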